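/- Let A be a finite alphabet with at least two letters and let 𝒜 = (V, (f_a)_{a∈A}) be a connected, incomplete inverse automaton over A on a finite vertex set V with m = |V| ≥ 3 vertices. Let q be the smallest prime strictly greater than m. Then for every natural number n ≥ m + q + 2 there exists a permutation automaton on an n-element set (say Fin n) extending 𝒜 whose transition group is exactly the alternating group: that is, there are an injection ι : V ↪ Fin n and permutations σ_a of Fin n (a ∈ A) satisfying σ_a(ι(v)) = ι(f_a(v)) whenever f_a(v) is defined, such that the subgroup of the symmetric group of Fin n generated by {σ_a : a ∈ A} equals the alternating group on Fin n. -/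

import Mathlib

open Equiv Equiv.Perm MulAction in
theorem cag_three_cycle {X : Type*} [Fintype X] [DecidableEq X] {q : ℕ} [Fact q.Prime]
    (c : ZMod q → X) (hc : Function.Injective c) (g τ : Perm X)
    (hg : ∀ i, g (c i) = c (i + 1)) (hg' : ∀ x, x ∉ Set.range c → g x = x)
    (hτ : ∀ i, i ≠ 0 → τ (c i) = c i) (hτ0 : τ (c 0) ∉ Set.range c) :
    IsThreeCycle (g⁻¹ * (τ * g * τ⁻¹)) := by
  set u := τ (c 0) with hu
  have huc : ∀ i, u ≠ c i := fun i h => hτ0 ⟨i, h.symm⟩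
  have h10 : (-1 : ZMod q) ≠ 0 := neg_ne_zero.mpr one_ne_zero
  have key : g⁻¹ * (τ * g * τ⁻¹) = swap u (c (-1)) * swap u (c 0) := by
    rw [inv_mul_eq_iff_eq_mul, mul_inv_eq_iff_eq_mul]
    ext x
    simp only [Perm.mul_apply]
    by_cases hx : x ∈ Set.range c
    · obtain ⟨i, rfl⟩ := hx
      rw [hg]
      by_cases hi : i = 0
      · subst hi
        rw [← hu, swap_apply_left, swap_apply_of_ne_of_ne (huc 0).symm (fun h => h10 (hc h).symm),
          hg, hτ _ (by simp)]
      · rw [hτ i hi, swap_apply_of_ne_of_ne (huc i).symm (fun h => hi (hc h))]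
        by_cases hi1 : i = -1
        · subst hi1
          rw [swap_apply_right, hg' u hτ0]
          simp [hu]
        · rw [swap_apply_of_ne_of_ne (huc i).symm (fun h => hi1 (hc h)), hg, hτ]
          intro h; exact hi1 (eq_neg_of_add_eq_zero_left h)
    · rw [hg' x hx]
      have hxu : τ x ≠ u := fun h => hx ⟨0, (τ.injective h).symm⟩
      by_cases hx0 : τ x = c 0
      · rw [hx0, swap_apply_right, swap_apply_left, hg]; simp
      · have hxc : τ x ∉ Set.range c := by
          rintro ⟨i, hi⟩
          have hi0 : i ≠ 0 := fun h => hx0 (by rw [← hi, h])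
          exact hx ⟨i, τ.injective (by rw [hτ i hi0, hi])⟩
        rw [swap_apply_of_ne_of_ne hxu hx0,
          swap_apply_of_ne_of_ne hxu (fun h => hxc ⟨_, h.symm⟩), hg' _ hxc]
  rw [key]
  exact isThreeCycle_swap_mul_swap_same (huc _) (huc _) (fun h => h10 (hc h))

open Equiv Equiv.Perm MulAction Pointwise in
theorem cag_abstract {X : Type*} [Fintype X] [DecidableEq X] {q : ℕ} [Fact q.Prime]
    (c : ZMod q → X) (hc : Function.Injective c) (g τ : Perm X)
    (hg : ∀ i, g (c i) = c (i + 1)) (hg' : ∀ x, x ∉ Set.range c → g x = x)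
    (hτ : ∀ i, i ≠ 0 → τ (c i) = c i) (hτ0 : τ (c 0) ∉ Set.range c)
    (S : Set (Perm X)) (hgS : g ∈ Subgroup.closure S) (hτS : τ ∈ Subgroup.closure S)
    (hS : ∀ s ∈ S, ∃ i j, s (c i) = c j) (hS' : ∀ s ∈ S, sign s = 1)
    (htr : ∀ x, ∃ h ∈ Subgroup.closure S, h (c 0) = x) :
    Subgroup.closure S = alternatingGroup X := by
  apply le_antisymm
  · rw [Subgroup.closure_le]
    exact fun s hs => mem_alternatingGroup.mpr (hS' s hs)
  have hpt : IsPretransitive (Subgroup.closure S) X :=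
    ((isPretransitive_iff_base (c 0)).mpr fun x => by
      obtain ⟨h, hh, hx⟩ := htr x
      exact ⟨⟨h, hh⟩, hx⟩)
  have h3 := cag_three_cycle c hc g τ hg hg' hτ hτ0
  refine alternatingGroup_le_of_isPreprimitive_of_isThreeCycle_mem ?_ h3
    (mul_mem (inv_mem hgS) (mul_mem (mul_mem hτS hgS) (inv_mem hτS)))
  refine IsPreprimitive.of_isTrivialBlock_base (c 0) ?_
  intro B h0 hB
  rw [isBlock_iff_smul_eq_of_mem] at hB
  have hB' : ∀ h ∈ Subgroup.closure S, ∀ x ∈ B, h x ∈ B → ∀ y ∈ B, h y ∈ B := by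
    intro h hh x hx hhx y hy
    have := hB (g := ⟨h, hh⟩) hx hhx
    rw [← this]
    exact Set.smul_mem_smul_set hy
  have hpow : ∀ (k : ℕ) i, (g ^ k) (c i) = c (i + k) := by
    intro k
    induction k with
    | zero => simp
    | succ k ih => intro i; rw [pow_succ, Perm.mul_apply, hg, ih]; push_cast; congr 1; ring
  by_cases hsub : B.Subsingleton
  · exact Or.inl hsub
  right
  have hCB : ∀ i, c i ∈ B := by
    obtain ⟨y, hy, hy0⟩ : ∃ y ∈ B, y ≠ c 0 := by
      by_contra! hcon
      exact hsub fun x hx y hy => (hcon x hx).trans (hcon y hy).symm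
    have : ∃ (k : ℕ), (k : ZMod q) ≠ 0 ∧ ∀ y ∈ B, (g ^ k) y ∈ B := by
      by_cases hyc : y ∈ Set.range c
      · obtain ⟨i, rfl⟩ := hyc
        have hi : i ≠ 0 := fun h => hy0 (by rw [h])
        refine ⟨i.val, by simpa using hi, hB' _ (pow_mem hgS _) (c 0) h0 ?_⟩
        rw [hpow]; simpa using hy
      · refine ⟨1, by simp, hB' _ (pow_mem hgS _) y hy ?_⟩
        rw [pow_one, hg' y hyc]; exact hy
    obtain ⟨k, hk, hkB⟩ := this
    have hall : ∀ j : ℕ, c (j * k) ∈ B := by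
      intro j
      induction j with
      | zero => simpa using h0
      | succ j ih =>
        have := hkB _ ih
        rw [hpow] at this
        convert this using 2
        push_cast; ring
    intro i
    have := hall (i * (k : ZMod q)⁻¹).val
    simpa [hk] using this
  have hinv : ∀ h ∈ Subgroup.closure S, ∀ y ∈ B, h y ∈ B := by
    intro h hh
    induction hh using Subgroup.closure_induction with
    | mem s hs =>
      obtain ⟨i, j, hij⟩ := hS s hs
      exact hB' s (Subgroup.subset_closure hs) (c i) (hCB i) (by rw [hij]; exact hCB j)
    | one => simp
    | mul x y _ _ hx hy => intro z hz; exact hx _ (hy _ hz)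
    | inv x hx' hx =>
      have := hB' x hx' (c 0) h0 (hx _ h0)
      have heq := hB (g := ⟨x, hx'⟩) h0 (hx _ h0)
      intro y hy
      rw [← heq] at hy
      obtain ⟨z, hz, rfl⟩ := hy
      change x⁻¹ (x z) ∈ B
      simpa using hz
  ext x
  obtain ⟨h, hh, rfl⟩ := htr x
  simpa using hinv h hh _ h0

theorem cag_extend {V : Type*} [Fintype V] (f : V → Option V)
    (hinj : ∀ v w u, f v = some u → f w = some u → v = w) :
    ∃ e : Equiv.Perm V, ∀ v w, f v = some w → e v = w := by
  classical
  obtain ⟨e, he⟩ := Finset.exists_equiv_extend_of_card_eq (α := V) (t := (Finset.univ : Finset V))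
    (by simp) (s := Finset.univ.filter fun v => (f v).isSome) (f := fun v => (f v).getD v)
    (by simp) (by
      intro v hv w hw h
      simp only [Finset.coe_filter, Finset.mem_univ, true_and, Set.mem_ofPred_eq,
        Option.isSome_iff_exists] at hv hw
      obtain ⟨x, hx⟩ := hv
      obtain ⟨y, hy⟩ := hw
      simp only [hx, hy, Option.getD_some] at h
      subst h
      exact hinj _ _ _ hx hy)
  refine ⟨e.trans (Equiv.subtypeUnivEquiv (by simp)), fun v w h => ?_⟩
  have := he v (by simp [h])
  simpa [h] using this

open Equiv Equiv.Perm in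
theorem cag_kappa (V : Type*) [Fintype V] [DecidableEq V] (s q : ℕ) [Fact q.Prime] (v₀ : V) :
    ∃ κ : Perm (V ⊕ (Fin (s + 2) ⊕ ZMod q)),
      κ (.inr (.inr 0)) = .inl v₀ ∧ (∃ r, κ (.inl v₀) = .inr (.inl r)) ∧
      (∀ v, v ≠ v₀ → κ (.inl v) = .inl v) ∧ (∀ i, i ≠ 0 → κ (.inr (.inr i)) = .inr (.inr i)) ∧
      (∀ r, ∃ k : ℕ, (κ ^ k) (.inl v₀) = .inr (.inl r)) ∧
      (∃ k : ℕ, (κ ^ k) (.inl v₀) = .inr (.inr 0)) := by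
  let L : List (V ⊕ (Fin (s + 2) ⊕ ZMod q)) := (List.finRange (s + 2)).map (fun r => (.inr (.inl r) : (V ⊕ (Fin (s + 2) ⊕ ZMod q))))
  let l : List (V ⊕ (Fin (s + 2) ⊕ ZMod q)) := .inl v₀ :: (L ++ [.inr (.inr 0)])
  have hL : L = .inr (.inl 0) :: ((List.finRange (s + 1)).map Fin.succ).map
      (fun r => (.inr (.inl r) : (V ⊕ (Fin (s + 2) ⊕ ZMod q)))) := by
    simp [L, List.finRange_succ]
  have hLn : L.Nodup := (List.nodup_finRange _).map (fun a b h => by simpa using h)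
  have hn : l.Nodup := by
    simp only [l, List.nodup_cons, List.nodup_append, hLn]
    simp [L]
  have hlen : 2 ≤ l.length := by simp [l]
  have hcyc := List.isCycle_formPerm hn hlen
  have hmem : ∀ x ∈ l, l.formPerm x ≠ x := by
    intro x hx
    exact (List.formPerm_apply_mem_ne_self_iff _ hn x hx).mpr hlen
  have hv : (Sum.inl v₀ : (V ⊕ (Fin (s + 2) ⊕ ZMod q))) ∈ l := by simp [l]
  refine ⟨l.formPerm, ?_, ⟨0, ?_⟩, ?_, ?_, ?_, ?_⟩
  · have := List.formPerm_apply_getLast (Sum.inl v₀ : (V ⊕ (Fin (s + 2) ⊕ ZMod q))) (L ++ [.inr (.inr 0)])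
    simpa [l] using this
  · have hl : l = .inl v₀ :: .inr (.inl 0) :: (((List.finRange (s + 1)).map Fin.succ).map
      (fun r => (.inr (.inl r) : (V ⊕ (Fin (s + 2) ⊕ ZMod q)))) ++ [.inr (.inr 0)]) := by
      simp only [l, hL, List.cons_append]
    rw [hl] at hn ⊢
    exact List.formPerm_apply_head _ _ _ hn
  · intro v hv
    exact List.formPerm_apply_of_notMem (by simp [l, L, hv])
  · intro i hi
    exact List.formPerm_apply_of_notMem (by simp [l, L, hi])
  · intro r
    exact hcyc.exists_pow_eq (hmem _ hv) (hmem _ (by simp [l, L]))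
  · exact hcyc.exists_pow_eq (hmem _ hv) (hmem _ (by simp [l, L]))

open Equiv Equiv.Perm in
theorem cag_sign_fix {X : Type*} [Fintype X] [DecidableEq X] (x y : X) (hxy : x ≠ y) (ε : ℤˣ) :
    ∃ ρ : Perm X, (ρ = 1 ∨ ρ = swap x y) ∧ ε * sign ρ = 1 := by
  rcases Int.units_eq_one_or ε with h | h
  · exact ⟨1, Or.inl rfl, by simp [h]⟩
  · exact ⟨swap x y, Or.inr rfl, by simp [h, sign_swap hxy]⟩

open Equiv Equiv.Perm in
theorem cag_construct (A V : Type) [Fintype V] [DecidableEq V] [DecidableEq A]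
    (a b : A) (hab : a ≠ b) (s q : ℕ) [Fact q.Prime] (hmq : Fintype.card V < q) (hq3 : 3 ≤ q)
    (f : A → V → Option V)
    (hinj : ∀ a v w u, f a v = some u → f a w = some u → v = w)
    (hconn : ∀ v w : V, Relation.EqvGen (fun x y => ∃ a, f a x = some y) v w)
    (v₀ : V) (hv₀ : f b v₀ = none) :
    ∃ σ : A → Perm (V ⊕ (Fin (s + 2) ⊕ ZMod q)),
      (∀ a v w, f a v = some w → σ a (.inl v) = .inl w) ∧
      Subgroup.closure (Set.range σ) = alternatingGroup (V ⊕ (Fin (s + 2) ⊕ ZMod q)) := by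
  have hqp : q.Prime := Fact.out
  have hqodd : Odd q := hqp.odd_of_ne_two (by omega)
  choose e he using fun x => cag_extend (f x) (hinj x)
  obtain ⟨κ, hκ0, ⟨r₀, hκv⟩, hκV, hκC, hκR, hκc⟩ := cag_kappa V s q v₀
  let rot : Perm (ZMod q) := Equiv.addRight 1
  have hrotpow : ∀ k : ℕ, ∀ i, (rot ^ k) i = i + k := by
    intro k
    induction k with
    | zero => simp
    | succ k ih => intro i; rw [pow_succ, Perm.mul_apply, ih]; simp [rot]; ring
  have hrots : sign rot = 1 := by
    have h1 : rot ^ q = 1 := by ext i; simp [hrotpow]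
    have h2 : sign rot ^ q = 1 := by rw [← map_pow, h1, map_one]
    rcases Int.units_eq_one_or (sign rot) with h | h
    · exact h
    · rw [h, hqodd.neg_one_pow] at h2; exact absurd h2 (by decide)
  have h12 : (1 : ZMod q) ≠ -1 := by
    intro h
    have : ((2 : ℕ) : ZMod q) = 0 := by
      push_cast; rw [← one_add_one_eq_two]; exact eq_neg_iff_add_eq_zero.mp h
    rw [ZMod.natCast_eq_zero_iff] at this
    have := Nat.le_of_dvd (by norm_num) this
    omega
  choose ρ hρ hρs using fun x => cag_sign_fix (0 : Fin (s + 2)) 1 (by simp) (sign (e x))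
  obtain ⟨ε, hε, hεs⟩ := cag_sign_fix (1 : ZMod q) (-1) h12 (sign (e b) * sign κ)
  have hε2 : ∀ i, ε (ε i) = i := by
    rcases hε with rfl | rfl <;> simp
  have hε0 : ε 0 = 0 := by
    rcases hε with rfl | rfl
    · simp
    · exact swap_apply_of_ne_of_ne (by simp) (by simp)
  have hρ2 : ∀ x, ρ x ^ 2 = 1 := by
    intro x; rcases hρ x with h | h <;> simp [h, pow_two]
  let E : Perm (V ⊕ (Fin (s + 2) ⊕ ZMod q)) := Perm.sumCongr (e b) (Perm.sumCongr 1 ε)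
  let σb : Perm (V ⊕ (Fin (s + 2) ⊕ ZMod q)) := E * κ
  let σ : A → Perm (V ⊕ (Fin (s + 2) ⊕ ZMod q)) := fun x => if x = b then σb else
    Perm.sumCongr (e x) (Perm.sumCongr (ρ x) (if x = a then rot else 1))
  have hσb : σ b = σb := by simp [σ]
  have hσa : σ a = Perm.sumCongr (e a) (Perm.sumCongr (ρ a) rot) := by simp [σ, hab]
  have hext : ∀ a v w, f a v = some w → σ a (.inl v) = .inl w := by
    intro x v w h
    by_cases hx : x = b
    · subst hx
      have hv : v ≠ v₀ := by rintro rfl; rw [hv₀] at h; cases h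
      rw [hσb]
      simp [σb, E, hκV v hv, he x v w h]
    · simp [σ, hx, he x v w h]
  refine ⟨σ, hext, ?_⟩
  let c : ZMod q → (V ⊕ (Fin (s + 2) ⊕ ZMod q)) := fun i => .inr (.inr i)
  have hcinj : Function.Injective c := fun i j h => by simpa [c] using h
  let g : Perm (V ⊕ (Fin (s + 2) ⊕ ZMod q)) := Perm.sumCongr 1 (Perm.sumCongr 1 rot)
  have hsub : ∀ x, σ x ∈ Subgroup.closure (Set.range σ) := fun x =>
    Subgroup.subset_closure ⟨x, rfl⟩
  have hgS : g ∈ Subgroup.closure (Set.range σ) := by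
    let N := 2 * (Fintype.card V).factorial
    have hN : ((N : ℕ) : ZMod q) ≠ 0 := by
      rw [Ne, ZMod.natCast_eq_zero_iff, hqp.dvd_mul, hqp.dvd_factorial]
      rintro (h | h)
      · have := Nat.le_of_dvd (by norm_num) h; omega
      · omega
    let M := (((N : ℕ) : ZMod q)⁻¹).val
    have hpow : ∀ k : ℕ, σ a ^ k = Perm.sumCongr (e a ^ k) (Perm.sumCongr (ρ a ^ k) (rot ^ k)) := by
      intro k
      rw [hσa]
      induction k with
      | zero => simp
      | succ k ih => rw [pow_succ, ih, Perm.sumCongr_mul, Perm.sumCongr_mul]; simp [pow_succ]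
    have : g = σ a ^ (N * M) := by
      rw [hpow]
      have h1 : e a ^ (N * M) = 1 := by
        have : e a ^ (Fintype.card V).factorial = 1 := by
          rw [← Fintype.card_perm]; exact pow_card_eq_one
        rw [pow_mul, pow_mul', this]; simp
      have h2 : ρ a ^ (N * M) = 1 := by
        rw [pow_mul, pow_mul, hρ2]; simp
      have h3 : rot ^ (N * M) = rot := by
        ext i
        rw [hrotpow]
        simp [rot, M, hN]
      rw [h1, h2, h3]
    rw [this]
    exact pow_mem (hsub a) _
  have hσbc : ∀ i, i ≠ 0 → σb (c i) = c (ε i) := by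
    intro i hi
    simp [σb, c, hκC i hi, E]
  have hε0' : ∀ i, i ≠ 0 → ε i ≠ 0 := fun i hi h => hi (ε.injective (h.trans hε0.symm))
  refine cag_abstract c hcinj g (σb ^ 2) ?_ ?_ ?_ ?_ _ hgS
    (pow_mem (hσb ▸ hsub b) 2) ?_ ?_ ?_
  · intro i; simp [g, c, rot]
  · rintro (x | x | x) hx
    · simp [g]
    · simp [g]
    · exact absurd ⟨x, rfl⟩ hx
  · intro i hi
    rw [pow_two, Perm.mul_apply, hσbc i hi, hσbc _ (hε0' i hi), hε2]
  · have h1 : σb (c 0) = .inl (e b v₀) := by simp [σb, c, hκ0, E]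
    rw [pow_two, Perm.mul_apply, h1]
    by_cases h : e b v₀ = v₀
    · simp [h, σb, hκv, E, c]
    · simp [σb, hκV _ h, E, c]
  · rintro _ ⟨x, rfl⟩
    by_cases hx : x = b
    · subst hx; exact ⟨1, ε 1, by rw [hσb, hσbc 1 one_ne_zero]⟩
    · exact ⟨0, (if x = a then rot else 1) 0, by simp [σ, hx, c]⟩
  · rintro _ ⟨x, rfl⟩
    by_cases hx : x = b
    · subst hx
      rw [hσb]
      simp only [σb, E, Perm.sign_mul, sign_sumCongr, Perm.sign_one, one_mul]
      rw [← hεs]; ac_rfl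
    · have : sign (if x = a then rot else 1) = 1 := by split_ifs <;> simp [hrots]
      simp [σ, hx, this, hρs]
  · -- transitivity
    set G := Subgroup.closure (Set.range σ) with hG
    let T : (V ⊕ (Fin (s + 2) ⊕ ZMod q)) → (V ⊕ (Fin (s + 2) ⊕ ZMod q)) → Prop := fun x y => ∃ h ∈ G, h x = y
    have Trefl : ∀ x, T x x := fun x => ⟨1, one_mem _, rfl⟩
    have Tsymm : ∀ x y, T x y → T y x := by
      rintro x _ ⟨h, hh, rfl⟩
      exact ⟨h⁻¹, inv_mem hh, by simp⟩
    have Ttrans : ∀ x y z, T x y → T y z → T x z := by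
      rintro x _ _ ⟨h, hh, rfl⟩ ⟨k, hk, rfl⟩
      exact ⟨k * h, mul_mem hk hh, rfl⟩
    have TV : ∀ v w : V, T (.inl v) (.inl w) := by
      intro v w
      induction hconn v w with
      | rel x y h => obtain ⟨d, hd⟩ := h; exact ⟨σ d, hsub d, hext d x y hd⟩
      | refl x => exact Trefl _
      | symm x y _ ih => exact Tsymm _ _ ih
      | trans x y z _ _ h1 h2 => exact Ttrans _ _ _ h1 h2
    have Tb : ∀ x, T x (σb x) := fun x => ⟨σb, hσb ▸ hsub b, rfl⟩
    have TK : ∀ k : ℕ, T (.inl v₀) ((κ ^ k) (.inl v₀)) := by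
      intro k
      induction k with
      | zero => exact Trefl _
      | succ k ih =>
        rw [pow_succ', Perm.mul_apply]
        generalize (κ ^ k) (.inl v₀) = y at ih ⊢
        rcases hz : κ y with v | r | i
        · exact TV _ _
        · have := Tb y
          have h2 : σb y = .inr (.inl r) := by simp [σb, hz, E]
          rw [h2] at this
          exact Ttrans _ _ _ ih this
        · by_cases hi : i = 0
          · subst hi
            have := Tb y
            have h2 : σb y = .inr (.inr 0) := by simp [σb, hz, E, hε0]
            rw [h2] at this
            exact Ttrans _ _ _ ih this
          · have : y = .inr (.inr i) := κ.injective (hz.trans (hκC i hi).symm)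
            rw [← this]; exact ih
    have T0 : T (.inl v₀) (c 0) := by
      obtain ⟨k, hk⟩ := hκc
      have := TK k
      rwa [hk] at this
    have T1 := Tsymm _ _ T0
    rintro (v | r | i)
    · exact Ttrans _ _ _ T1 (TV _ _)
    · obtain ⟨k, hk⟩ := hκR r
      have := TK k
      rw [hk] at this
      exact Ttrans _ _ _ T1 this
    · refine ⟨g ^ i.val, pow_mem hgS _, ?_⟩
      have : ∀ k : ℕ, (g ^ k) (c 0) = c k := by
        intro k
        induction k with
        | zero => simp
        | succ k ih => rw [pow_succ', Perm.mul_apply, ih]; simp [g, c, rot]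
      rw [this]; simp [c]


/-- A connected incomplete inverse automaton on `m ≥ 3` vertices
over an alphabet with at least two letters can, for every `n ≥ m + q + 2`
(`q` the smallest prime `> m`), be extended to a permutation automaton on `n`
points whose transition group is exactly the alternating group. -/
theorem completing_to_alternating_group
    (A V : Type) [Fintype A] [Fintype V]
    (hA : 2 ≤ Fintype.card A)
    (m : ℕ) (hmV : Fintype.card V = m) (hm : 3 ≤ m)
    -- `f a` is the partial injective map induced by the letter `a`
    (f : A → V → Option V)
    (hinj : ∀ a v w u, f a v = some u → f a w = some u → v = w)
    -- connectedness
    (hconn : ∀ v w : V, Relation.EqvGen (fun x y => ∃ a, f a x = some y) v w)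
    -- incompleteness: some letter does not induce a total bijection
    (hincomplete : ∃ a v, f a v = none)
    -- `q` is the smallest prime strictly greater than `m`
    (q : ℕ) (hq : q.Prime) (hmq : m < q)
    (hqmin : ∀ q' : ℕ, q'.Prime → m < q' → q ≤ q')
    (n : ℕ) (hn : m + q + 2 ≤ n) :
    ∃ (ι : V ↪ Fin n) (σ : A → Equiv.Perm (Fin n)),
      (∀ a v w, f a v = some w → σ a (ι v) = ι w) ∧
      Subgroup.closure (Set.range σ) = alternatingGroup (Fin n) := by
  classical
  have : Fact q.Prime := ⟨hq⟩
  obtain ⟨b, v₀, hb⟩ := hincomplete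
  have : Nontrivial A := Fintype.one_lt_card_iff_nontrivial.mp hA
  obtain ⟨a, hab⟩ := exists_ne b
  obtain ⟨s, rfl⟩ := Nat.exists_eq_add_of_le hn
  obtain ⟨σ, hσ, hcl⟩ := cag_construct A V a b hab s q (by omega) (by omega) f hinj hconn v₀ hb
  have hcard : Fintype.card (V ⊕ (Fin (s + 2) ⊕ ZMod q)) = m + q + 2 + s := by
    simp [ZMod.card, hmV]; ring
  let e := Fintype.equivFinOfCardEq hcard
  refine ⟨⟨fun v => e (.inl v), fun v w h => by simpa using h⟩,
    fun x => e.permCongr (σ x), ?_, ?_⟩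
  · intro x v w h
    change e (σ x (e.symm (e (.inl v)))) = e (.inl w)
    rw [e.symm_apply_apply, hσ x v w h]
  · have h1 : Set.range (fun x => e.permCongr (σ x)) =
        e.permCongrHom.toMonoidHom '' Set.range σ := by
      rw [← Set.range_comp]; rfl
    rw [h1, ← MonoidHom.map_closure, hcl]
    ext p
    rw [Subgroup.mem_map, Equiv.Perm.mem_alternatingGroup]
    constructor
    · rintro ⟨x, hx, rfl⟩
      rw [Equiv.Perm.mem_alternatingGroup] at hx
      rw [← hx]
      exact Equiv.Perm.sign_permCongr e x
    · intro hp
      refine ⟨e.permCongr.symm p, ?_, e.permCongr.apply_symm_apply p⟩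
      rw [Equiv.Perm.mem_alternatingGroup, ← hp, ← Equiv.Perm.sign_permCongr e]
      simp
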